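/- arXiv:1405.0598 — 4 statements merged into one kernel-verified Lean document; each statement's English description precedes it below -/
import Mathlib

section
/- Let B₁, B₂, B₃ be symmetric r×r real matrices and, for i = 1,2,3, set Aᵢ = Matrix.fromBlocks(tᵢ, 0, 0, Bᵢ), where tᵢ is the 1×1 matrix with single entry −trace(Bᵢ). Then ⁅⁅A₁,A₂⁆,A₃⁆ = Matrix.fromBlocks(0, 0, 0, ⁅⁅B₁,B₂⁆,B₃⁆), and the matrix ⁅⁅B₁,B₂⁆,B₃⁆ is symmetric with trace zero. -/
open Matrix

/-- The commutator of block diagonal matrices is computed blockwise. -/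
theorem Matrix.lie_fromBlocks_diagonal {m n R : Type*} [Fintype m] [Fintype n] [CommRing R]
    (P P' : Matrix m m R) (S S' : Matrix n n R) :
    ⁅fromBlocks P 0 0 S, fromBlocks P' 0 0 S'⁆ = fromBlocks ⁅P, P'⁆ 0 0 ⁅S, S'⁆ := by
  simp [Ring.lie_def, fromBlocks_multiply, sub_eq_add_neg, fromBlocks_neg, fromBlocks_add]

/-- Matrices indexed by a type with a unique element commute. -/
theorem Matrix.lie_eq_zero_of_unique {m R : Type*} [Fintype m] [Unique m]
    [CommRing R] (P P' : Matrix m m R) : ⁅P, P'⁆ = 0 := by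
  ext i j
  simp [Ring.lie_def, mul_apply, Unique.eq_default i, Unique.eq_default j, mul_comm]

/-- For symmetric `r × r` real matrices `B₁, B₂, B₃` and the block matrices
`Aᵢ = fromBlocks tᵢ 0 0 Bᵢ` with `tᵢ` the `1 × 1` matrix with entry `-trace Bᵢ`,
one has `⁅⁅A₁,A₂⁆,A₃⁆ = fromBlocks 0 0 0 ⁅⁅B₁,B₂⁆,B₃⁆`, and the matrix
`⁅⁅B₁,B₂⁆,B₃⁆` is symmetric with trace zero. -/
theorem stmt1 (r : ℕ) (B₁ B₂ B₃ : Matrix (Fin r) (Fin r) ℝ)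
    (h₁ : B₁ᵀ = B₁) (h₂ : B₂ᵀ = B₂) (h₃ : B₃ᵀ = B₃)
    (A₁ A₂ A₃ : Matrix (Fin 1 ⊕ Fin r) (Fin 1 ⊕ Fin r) ℝ)
    (hA₁ : A₁ = Matrix.fromBlocks (Matrix.of fun _ _ => -B₁.trace) 0 0 B₁)
    (hA₂ : A₂ = Matrix.fromBlocks (Matrix.of fun _ _ => -B₂.trace) 0 0 B₂)
    (hA₃ : A₃ = Matrix.fromBlocks (Matrix.of fun _ _ => -B₃.trace) 0 0 B₃) :
    ⁅⁅A₁, A₂⁆, A₃⁆ = Matrix.fromBlocks 0 0 0 ⁅⁅B₁, B₂⁆, B₃⁆ ∧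
    (⁅⁅B₁, B₂⁆, B₃⁆)ᵀ = ⁅⁅B₁, B₂⁆, B₃⁆ ∧
    (⁅⁅B₁, B₂⁆, B₃⁆).trace = 0 := by
  subst hA₁ hA₂ hA₃
  refine ⟨?_, ?_, ?_⟩
  · simp only [lie_fromBlocks_diagonal, lie_eq_zero_of_unique]
  · rw [lie_transpose, lie_transpose, h₁, h₂, h₃]
    simp only [Ring.lie_def]
    noncomm_ring
  · exact LieAlgebra.matrix_trace_commutator_zero _ _ _ _
end

section
/- Every element of 𝔪 belongs to 𝔭, and 𝔪 is a Lie triple system in the Lie algebra of (2r+k)×(2r+k) real matrices: for all X, Y, Z ∈ 𝔪 one has ⁅⁅X,Y⁆,Z⁆ ∈ 𝔪. -/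
open Matrix

/-- The set `𝔭` of real block matrices `fromBlocks 0 B Bᵀ 0` (blocks indexed by
`Fin r ⊕ Fin (r+k)`), where `B` ranges over all `r × (r+k)` real matrices. -/
def pSO (r k : ℕ) : Set (Matrix (Fin r ⊕ Fin (r + k)) (Fin r ⊕ Fin (r + k)) ℝ) :=
  {A | ∃ B : Matrix (Fin r) (Fin (r + k)) ℝ, A = Matrix.fromBlocks 0 B Bᵀ 0}

/-- The subset `𝔪` of `𝔭` consisting of those `fromBlocks 0 B Bᵀ 0` for which the
last column of `B` is zero. -/
def mSO (r k : ℕ) : Set (Matrix (Fin r ⊕ Fin (r + k)) (Fin r ⊕ Fin (r + k)) ℝ) :=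
  {A | ∃ B : Matrix (Fin r) (Fin (r + k)) ℝ,
    (∀ (i : Fin r) (j : Fin (r + k)), (j : ℕ) = r + k - 1 → B i j = 0) ∧
    A = Matrix.fromBlocks 0 B Bᵀ 0}

/-- The double commutator of off-diagonal symmetric block matrices is again of this form. -/
theorem lie_lie_fromBlocks_offDiag {m n R : Type*} [Fintype m] [Fintype n] [DecidableEq m]
    [DecidableEq n] [CommRing R] (B C D : Matrix m n R) :
    ⁅⁅Matrix.fromBlocks 0 B Bᵀ 0, Matrix.fromBlocks 0 C Cᵀ 0⁆, Matrix.fromBlocks 0 D Dᵀ 0⁆ =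
      Matrix.fromBlocks 0 ((B * Cᵀ - C * Bᵀ) * D - D * (Bᵀ * C - Cᵀ * B))
        ((B * Cᵀ - C * Bᵀ) * D - D * (Bᵀ * C - Cᵀ * B))ᵀ 0 := by
  simp only [Ring.lie_def, sub_eq_add_neg, Matrix.fromBlocks_multiply, Matrix.fromBlocks_neg,
    Matrix.fromBlocks_add, Matrix.zero_mul, Matrix.mul_zero, zero_add, add_zero, neg_zero,
    Matrix.transpose_add, Matrix.transpose_neg, Matrix.transpose_mul, Matrix.transpose_transpose]
  congr 1
  simp only [Matrix.mul_add, Matrix.add_mul, Matrix.mul_neg, Matrix.neg_mul]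
  abel

/-- A vanishing column of the right factor gives a vanishing column of the product. -/
theorem mul_apply_eq_zero_of_col {l m n R : Type*} [Fintype m] [NonUnitalNonAssocSemiring R]
    (A : Matrix l m R) {B : Matrix m n R} {j : n} (hB : ∀ i, B i j = 0) (i : l) :
    (A * B) i j = 0 := by
  simp [Matrix.mul_apply, hB]

/-- Every element of `𝔪` belongs to `𝔭`, and `𝔪` is a Lie triple system in the
Lie algebra of `(2r+k) × (2r+k)` real matrices. -/
theorem stmt3 (r k : ℕ) (hr : 1 ≤ r) :
    (∀ X ∈ mSO r k, X ∈ pSO r k) ∧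
    (∀ X ∈ mSO r k, ∀ Y ∈ mSO r k, ∀ Z ∈ mSO r k, ⁅⁅X, Y⁆, Z⁆ ∈ mSO r k) := by
  refine ⟨fun X ⟨B, _, hX⟩ => ⟨B, hX⟩, ?_⟩
  rintro _ ⟨B, hB, rfl⟩ _ ⟨C, hC, rfl⟩ _ ⟨D, hD, rfl⟩
  refine ⟨_, fun i j hj => ?_, lie_lie_fromBlocks_offDiag B C D⟩
  rw [Matrix.mul_sub, ← Matrix.mul_assoc, ← Matrix.mul_assoc]
  simp only [Matrix.sub_apply, mul_apply_eq_zero_of_col _ (fun i => hB i j hj),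
    mul_apply_eq_zero_of_col _ (fun i => hC i j hj),
    mul_apply_eq_zero_of_col _ (fun i => hD i j hj), sub_zero]
end

section
/- Let L be a Lie algebra over a commutative ring and let 𝔟, 𝔞 be submodules of L such that ⁅a,b⁆ = 0 for all a ∈ 𝔞 and b ∈ 𝔟, ⁅a,a'⁆ = 0 for all a, a' ∈ 𝔞, and ⁅⁅b₁,b₂⁆,b₃⁆ ∈ 𝔟 for all b₁, b₂, b₃ ∈ 𝔟. Let 𝔪 be a submodule of L contained in 𝔟 + 𝔞 satisfying ⁅⁅x,y⁆,z⁆ ∈ 𝔪 for all x, y, z ∈ 𝔪. Then the projected set S = {b ∈ 𝔟 : ∃ a ∈ 𝔞, b + a ∈ 𝔪} is again a Lie triple system: for all b₁, b₂, b₃ ∈ S one has ⁅⁅b₁,b₂⁆,b₃⁆ ∈ S. -/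
/-- Let `L` be a Lie algebra over a commutative ring with submodules `𝔟`, `𝔞` such
that `⁅𝔞,𝔟⁆ = 0`, `⁅𝔞,𝔞⁆ = 0` and `𝔟` is a Lie triple system. If `𝔪` is a submodule
contained in `𝔟 + 𝔞` which is a Lie triple system, then the projected set
`S = {b ∈ 𝔟 | ∃ a ∈ 𝔞, b + a ∈ 𝔪}` is again a Lie triple system. -/
theorem stmt6 {R L : Type*} [CommRing R] [LieRing L] [LieAlgebra R L]
    (b a m : Submodule R L)
    (hab : ∀ x ∈ a, ∀ y ∈ b, ⁅x, y⁆ = 0)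
    (haa : ∀ x ∈ a, ∀ y ∈ a, ⁅x, y⁆ = 0)
    (hbts : ∀ x ∈ b, ∀ y ∈ b, ∀ z ∈ b, ⁅⁅x, y⁆, z⁆ ∈ b)
    (hm : m ≤ b ⊔ a)
    (hmts : ∀ x ∈ m, ∀ y ∈ m, ∀ z ∈ m, ⁅⁅x, y⁆, z⁆ ∈ m)
    (S : Set L) (hS : S = {x | x ∈ b ∧ ∃ y ∈ a, x + y ∈ m}) :
    ∀ x ∈ S, ∀ y ∈ S, ∀ z ∈ S, ⁅⁅x, y⁆, z⁆ ∈ S := by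
  subst hS
  have hba : ∀ x ∈ b, ∀ y ∈ a, ⁅x, y⁆ = 0 := fun x hx y hy => by
    rw [← lie_skew, hab y hy x hx, neg_zero]
  rintro x ⟨hx, u, hu, hxu⟩ y ⟨hy, v, hv, hyv⟩ z ⟨hz, w, hw, hzw⟩
  refine ⟨hbts x hx y hy z hz, 0, a.zero_mem, ?_⟩
  have hxy : ⁅x + u, y + v⁆ = ⁅x, y⁆ := by
    simp only [add_lie, lie_add, hba x hx v hv, hab u hu y hy, haa u hu v hv, add_zero]
  have hxyw : ⁅⁅x, y⁆, w⁆ = 0 := by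
    rw [lie_lie, hba y hy w hw, hba x hx w hw, lie_zero, lie_zero, sub_zero]
  have hmem := hmts _ hxu _ hyv _ hzw
  rw [hxy, lie_add, hxyw] at hmem
  exact hmem
end

section
/- Let F be a field of characteristic zero, let L be a Lie algebra over F, and let H ∈ L be an element such that (ad H)³ = ad H, where ad H : L → L is the adjoint map x ↦ ⁅H,x⁆. Then the linear map σ = id − 2·(ad H)² is an involutive Lie algebra automorphism of L: σ(σ(x)) = x for all x ∈ L, and σ(⁅x,y⁆) = ⁅σ(x), σ(y)⁆ for all x, y ∈ L. -/
/-- If `(ad H)³ = ad H`, then the brackets of the first and of the second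
iterates applied to two elements are opposite to each other. -/
theorem lie_sq_lie_sq_add_lie_lie_eq_zero (F : Type*) {L : Type*} [Field F] [CharZero F]
    [LieRing L] [LieAlgebra F L] {H : L} (h : ∀ x : L, ⁅H, ⁅H, ⁅H, x⁆⁆⁆ = ⁅H, x⁆) (x y : L) :
    ⁅⁅H, ⁅H, x⁆⁆, ⁅H, ⁅H, y⁆⁆⁆ + ⁅⁅H, x⁆, ⁅H, y⁆⁆ = 0 := by
  have key := h ⁅x, ⁅H, y⁆⁆
  simp only [leibniz_lie H x, leibniz_lie H ⁅H, x⁆, leibniz_lie H ⁅H, ⁅H, x⁆⁆, lie_add, h] at key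
  have h3 : (3 : F) • (⁅⁅H, ⁅H, x⁆⁆, ⁅H, ⁅H, y⁆⁆⁆ + ⁅⁅H, x⁆, ⁅H, y⁆⁆) = 0 := by
    rw [← sub_eq_zero] at key
    rw [← key]
    module
  exact (smul_eq_zero.mp h3).resolve_left three_ne_zero

/-- If `H` is an element of a Lie algebra `L` over a field of characteristic zero
with `(ad H)³ = ad H`, then `σ = id - 2 (ad H)²` is an involutive Lie algebra
automorphism of `L`. -/
theorem stmt7 {F L : Type*} [Field F] [CharZero F] [LieRing L] [LieAlgebra F L]
    (H : L) (hH : (LieAlgebra.ad F L H) ^ 3 = LieAlgebra.ad F L H)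
    (σ : L →ₗ[F] L)
    (hσ : σ = LinearMap.id - 2 • ((LieAlgebra.ad F L H) ^ 2 : Module.End F L)) :
    (∀ x, σ (σ x) = x) ∧ (∀ x y, σ ⁅x, y⁆ = ⁅σ x, σ y⁆) := by
  have h (x : L) : ⁅H, ⁅H, ⁅H, x⁆⁆⁆ = ⁅H, x⁆ := by
    simpa [pow_succ] using LinearMap.congr_fun hH x
  have hs (x : L) : σ x = x - 2 • ⁅H, ⁅H, x⁆⁆ := by
    simp [hσ, pow_succ]
  refine ⟨fun x ↦ ?_, fun x y ↦ ?_⟩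
  · simp only [hs, lie_sub, lie_nsmul, h]
    module
  · have key := eq_neg_of_add_eq_zero_left (lie_sq_lie_sq_add_lie_lie_eq_zero F h x y)
    have hl : ⁅H, ⁅H, ⁅x, y⁆⁆⁆ =
        ⁅⁅H, ⁅H, x⁆⁆, y⁆ + 2 • ⁅⁅H, x⁆, ⁅H, y⁆⁆ + ⁅x, ⁅H, ⁅H, y⁆⁆⁆ := by
      simp only [leibniz_lie H x, leibniz_lie H ⁅H, x⁆, lie_add]
      module
    simp only [hs, hl, lie_sub, sub_lie, lie_nsmul, nsmul_lie, key]
    module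
end
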